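/- arXiv:2206.11654 — 4 statements merged into one kernel-verified Lean document; each statement's English description precedes it below -/
import Mathlib

section
/- Let V be a type with decidable equality, let w : V → V → ℝ be a weight function with nonnegative values, and let X, Y, Z be finite nonempty subsets of V that are pairwise disjoint. Then W(X ∪ Y, Z) ≥ min(W(X,Z), W(Y,Z)); i.e., merging two clusters never makes their average-linkage similarity to a third cluster smaller than the minimum of the two original similarities. -/
open Finset

/-- Average-linkage similarity between two clusters:
`W(X,Y) = (∑_{x∈X} ∑_{y∈Y} w x y) / (|X|·|Y|)`. -/
noncomputable def avgLinkage {V : Type*} [DecidableEq V] (w : V → V → ℝ)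
    (X Y : Finset V) : ℝ :=
  (∑ x ∈ X, ∑ y ∈ Y, w x y) / ((X.card : ℝ) * (Y.card : ℝ))

/-- The mediant of two fractions with positive denominators is at least their minimum. -/
theorem min_le_add_div_add {K : Type*} [Field K] [LinearOrder K] [IsStrictOrderedRing K]
    (a b : K) {p q : K} (hp : 0 < p) (hq : 0 < q) :
    min (a / p) (b / q) ≤ (a + b) / (p + q) := by
  rw [le_div_iff₀ (add_pos hp hq), mul_add]
  exact add_le_add ((le_div_iff₀ hp).1 (min_le_left _ _)) ((le_div_iff₀ hq).1 (min_le_right _ _))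

/-- Merging two clusters never makes their average-linkage similarity to a
third cluster smaller than the minimum of the two original similarities:
`W(X ∪ Y, Z) ≥ min (W(X,Z)) (W(Y,Z))`. -/
theorem avgLinkage_union_ge_min {V : Type*} [DecidableEq V] (w : V → V → ℝ)
    (hw : ∀ u v, 0 ≤ w u v) (X Y Z : Finset V)
    (hX : X.Nonempty) (hY : Y.Nonempty) (hZ : Z.Nonempty)
    (hXY : Disjoint X Y) (hXZ : Disjoint X Z) (hYZ : Disjoint Y Z) :
    min (avgLinkage w X Z) (avgLinkage w Y Z) ≤ avgLinkage w (X ∪ Y) Z := by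
  have hX' : (0 : ℝ) < X.card := by exact_mod_cast hX.card_pos
  have hY' : (0 : ℝ) < Y.card := by exact_mod_cast hY.card_pos
  have hZ' : (0 : ℝ) < Z.card := by exact_mod_cast hZ.card_pos
  unfold avgLinkage
  rw [sum_union hXY, card_union_of_disjoint hXY, Nat.cast_add, add_mul]
  exact min_le_add_div_add _ _ (mul_pos hX' hZ') (mul_pos hY' hZ')
end

section
/- The maximum pairwise average-linkage similarity is non-increasing under a merge: let V be a type with decidable equality, let w : V → V → ℝ be a weight function with nonnegative values, and let P be a finite collection of pairwise disjoint nonempty finite subsets of V containing at least two distinct members X and Y. Let P' be the collection obtained from P by removing X and Y and inserting X ∪ Y. Then for every pair of distinct clusters A', B' ∈ P', there exists a pair of distinct clusters A, B ∈ P with W(A',B') ≤ W(A,B); in particular the maximum of W over distinct pairs of clusters of P' is at most the maximum of W over distinct pairs of clusters of P. -/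
open Finset

theorem avgLinkage_flip {V : Type*} [DecidableEq V] (w : V → V → ℝ) (X Y : Finset V) :
    avgLinkage (flip w) X Y = avgLinkage w Y X := by
  unfold avgLinkage flip
  rw [Finset.sum_comm, mul_comm]

/-- The similarity of a merged cluster to `Z` is a weighted mean of the similarities of
its two parts to `Z`, hence at most their maximum. -/
theorem avgLinkage_union_left_le_max {V : Type*} [DecidableEq V] (w : V → V → ℝ)
    {X Y : Finset V} (hX : X.Nonempty) (hY : Y.Nonempty) (hXY : Disjoint X Y) (Z : Finset V) :
    avgLinkage w (X ∪ Y) Z ≤ max (avgLinkage w X Z) (avgLinkage w Y Z) := by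
  have hx : (0 : ℝ) < X.card := by exact_mod_cast hX.card_pos
  have hy : (0 : ℝ) < Y.card := by exact_mod_cast hY.card_pos
  unfold avgLinkage
  rw [Finset.sum_union hXY, Finset.card_union_of_disjoint hXY, Nat.cast_add]
  simp only [div_mul_eq_div_div_swap, add_div _ _ (Z.card : ℝ)]
  rw [div_le_iff₀ (add_pos hx hy), mul_add]
  exact add_le_add ((div_le_iff₀ hx).1 (le_max_left _ _)) ((div_le_iff₀ hy).1 (le_max_right _ _))

theorem avgLinkage_union_right_le_max {V : Type*} [DecidableEq V] (w : V → V → ℝ)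
    {X Y : Finset V} (hX : X.Nonempty) (hY : Y.Nonempty) (hXY : Disjoint X Y) (Z : Finset V) :
    avgLinkage w Z (X ∪ Y) ≤ max (avgLinkage w Z X) (avgLinkage w Z Y) := by
  simpa only [avgLinkage_flip] using avgLinkage_union_left_le_max (flip w) hX hY hXY Z

/-- The maximum pairwise average-linkage similarity is non-increasing under a
merge: if `P'` is obtained from the partition `P` (a finite collection of
pairwise disjoint nonempty finite clusters) by replacing two distinct clusters
`X, Y ∈ P` with `X ∪ Y`, then every pair of distinct clusters of `P'` has
similarity bounded by that of some pair of distinct clusters of `P`. -/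
theorem avgLinkage_merge_max_nonincreasing {V : Type*} [DecidableEq V]
    (w : V → V → ℝ) (hw : ∀ u v, 0 ≤ w u v)
    (P : Finset (Finset V))
    (hdisj : (P : Set (Finset V)).Pairwise (fun A B => Disjoint A B))
    (hne : ∀ A ∈ P, A.Nonempty)
    (X Y : Finset V) (hXP : X ∈ P) (hYP : Y ∈ P) (hXY : X ≠ Y)
    (P' : Finset (Finset V))
    (hP' : P' = insert (X ∪ Y) ((P.erase X).erase Y)) :
    ∀ A' ∈ P', ∀ B' ∈ P', A' ≠ B' →
      ∃ A ∈ P, ∃ B ∈ P, A ≠ B ∧ avgLinkage w A' B' ≤ avgLinkage w A B := by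
  subst hP'
  have hd : Disjoint X Y := hdisj hXP hYP hXY
  intro A' hA' B' hB' hne'
  simp only [Finset.mem_insert, Finset.mem_erase] at hA' hB'
  rcases hA' with rfl | ⟨hAY, hAX, hA⟩ <;> rcases hB' with rfl | ⟨hBY, hBX, hB⟩
  · exact absurd rfl hne'
  · rcases le_max_iff.1 (avgLinkage_union_left_le_max w (hne X hXP) (hne Y hYP) hd B') with h | h
    · exact ⟨X, hXP, B', hB, hBX.symm, h⟩
    · exact ⟨Y, hYP, B', hB, hBY.symm, h⟩
  · rcases le_max_iff.1 (avgLinkage_union_right_le_max w (hne X hXP) (hne Y hYP) hd A') with h | h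
    · exact ⟨A', hA, X, hXP, hAX, h⟩
    · exact ⟨A', hA, Y, hYP, hAY, h⟩
  · exact ⟨A', hA, B', hB, hne', le_rfl⟩
end

section
/- Stability of average-linkage weights under bounded cluster growth: let V be a type with decidable equality, let w : V → V → ℝ be a weight function with nonnegative values, let δ ≥ 0, and let X ⊆ X' and Y ⊆ Y' be finite nonempty subsets of V with X' and Y' disjoint, |X'| ≤ (1+δ)·|X| and |Y'| ≤ (1+δ)·|Y|. Then W(X',Y') ≥ W(X,Y) / (1+δ)². -/
open Finset

/-- The total cut weight between two clusters is monotone in both clusters. -/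
theorem sum_cut_le_sum_cut {V : Type*} {w : V → V → ℝ} (hw : ∀ u v, 0 ≤ w u v)
    {X X' Y Y' : Finset V} (hXX' : X ⊆ X') (hYY' : Y ⊆ Y') :
    ∑ x ∈ X, ∑ y ∈ Y, w x y ≤ ∑ x ∈ X', ∑ y ∈ Y', w x y :=
  (sum_le_sum fun x _ => sum_le_sum_of_subset_of_nonneg hYY' fun y _ _ => hw x y).trans
    (sum_le_sum_of_subset_of_nonneg hXX' fun x _ _ => sum_nonneg fun y _ => hw x y)

/-- Stability of average-linkage weights under bounded cluster growth:
if `X` grows to `X'` and `Y` grows to `Y'`, each by at most a `(1+δ)` factor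
in size, then `W(X',Y') ≥ W(X,Y) / (1+δ)²`. -/
theorem avgLinkage_stable_under_growth {V : Type*} [DecidableEq V]
    (w : V → V → ℝ) (hw : ∀ u v, 0 ≤ w u v) (δ : ℝ) (hδ : 0 ≤ δ)
    (X X' Y Y' : Finset V) (hX : X.Nonempty) (hY : Y.Nonempty)
    (hXX' : X ⊆ X') (hYY' : Y ⊆ Y') (hdisj : Disjoint X' Y')
    (hcardX : (X'.card : ℝ) ≤ (1 + δ) * (X.card : ℝ))
    (hcardY : (Y'.card : ℝ) ≤ (1 + δ) * (Y.card : ℝ)) :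
    avgLinkage w X Y / (1 + δ) ^ 2 ≤ avgLinkage w X' Y' := by
  have hX' : (0 : ℝ) < X'.card := by exact_mod_cast (hX.mono hXX').card_pos
  have hY' : (0 : ℝ) < Y'.card := by exact_mod_cast (hY.mono hYY').card_pos
  have hcut : ∑ x ∈ X, ∑ y ∈ Y, w x y ≤ ∑ x ∈ X', ∑ y ∈ Y', w x y :=
    sum_cut_le_sum_cut hw hXX' hYY'
  unfold avgLinkage
  rw [div_div]
  refine div_le_div₀ (sum_nonneg fun x _ => sum_nonneg fun y _ => hw x y) hcut
    (mul_pos hX' hY') ?_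
  calc (X'.card : ℝ) * Y'.card
      ≤ ((1 + δ) * X.card) * ((1 + δ) * Y.card) := by gcongr
    _ = X.card * Y.card * (1 + δ) ^ 2 := by ring
end

section
/- Heavy edges remain heavy while a cluster grows by at most a (1+ε) factor: let V be a type with decidable equality, let w : V → V → ℝ be a weight function with nonnegative values, let ε ≥ 0 and T > 0, and let X ⊆ X' and Y be finite nonempty subsets of V with X' disjoint from Y and |X'| ≤ (1+ε)·|X|. If the edge (X,Y) is (1+ε)-heavy, i.e., W(X,Y) ≥ T / (1+ε), then after the growth of X to X' the edge is still (1+ε)²-heavy, i.e., W(X',Y) ≥ T / (1+ε)². -/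
open Finset

/-- Heavy edges remain heavy while a cluster grows by at most a `(1+ε)`
factor: if `W(X,Y) ≥ T / (1+ε)` (the edge is `(1+ε)`-heavy) and `X` grows to
`X'` with `|X'| ≤ (1+ε)·|X|`, then `W(X',Y) ≥ T / (1+ε)²` (the edge is still
`(1+ε)²`-heavy). -/
theorem heavy_edge_remains_heavy {V : Type*} [DecidableEq V]
    (w : V → V → ℝ) (hw : ∀ u v, 0 ≤ w u v) (ε T : ℝ) (hε : 0 ≤ ε)
    (hT : 0 < T)
    (X X' Y : Finset V) (hX : X.Nonempty) (hY : Y.Nonempty)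
    (hXX' : X ⊆ X') (hdisj : Disjoint X' Y)
    (hcard : (X'.card : ℝ) ≤ (1 + ε) * (X.card : ℝ))
    (hheavy : T / (1 + ε) ≤ avgLinkage w X Y) :
    T / (1 + ε) ^ 2 ≤ avgLinkage w X' Y := by
  have hε' : 0 < 1 + ε := by linarith
  have hY' : (0 : ℝ) < Y.card := by exact_mod_cast hY.card_pos
  have hX' : (0 : ℝ) < X'.card := by exact_mod_cast (hX.mono hXX').card_pos
  have hsum : ∑ x ∈ X, ∑ y ∈ Y, w x y ≤ ∑ x ∈ X', ∑ y ∈ Y, w x y :=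
    Finset.sum_le_sum_of_subset_of_nonneg hXX'
      fun x _ _ => Finset.sum_nonneg fun y _ => hw x y
  have hnonneg : 0 ≤ ∑ x ∈ X', ∑ y ∈ Y, w x y :=
    Finset.sum_nonneg fun x _ => Finset.sum_nonneg fun y _ => hw x y
  unfold avgLinkage at *
  calc T / (1 + ε) ^ 2 = T / (1 + ε) / (1 + ε) := by rw [div_div, sq]
    _ ≤ (∑ x ∈ X, ∑ y ∈ Y, w x y) / ((X.card : ℝ) * Y.card) / (1 + ε) := by gcongr
    _ ≤ (∑ x ∈ X', ∑ y ∈ Y, w x y) / ((X.card : ℝ) * Y.card) / (1 + ε) := by gcongr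
    _ = (∑ x ∈ X', ∑ y ∈ Y, w x y) / ((1 + ε) * X.card * Y.card) := by
      rw [div_div]; congr 1; ring
    _ ≤ (∑ x ∈ X', ∑ y ∈ Y, w x y) / ((X'.card : ℝ) * Y.card) := by gcongr
end
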